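/- Fix integers n ≥ 1 and L ≥ 2, and for each subset X ⊆ {1,…,L} let y_X = (1 + (−1)^{|X| + R(L)})/2 where R(L) = 1 if L ≡ 0 (mod 4) and R(L) = 0 otherwise. Consider the probability distribution P(ā, b | x̄, y) = 2^{−(nL+1)} [1 + (−1)^{b + ∑_{j,k} a_j^k} ∏_{j=1}^{n} cos((π/2)(∑_{k=1}^{L} x_j^k + y))] on outcomes ā ∈ {0,1}^{nL}, b ∈ {0,1} given settings x̄ ∈ {0,1}^{nL}, y ∈ {0,1}, and define K_X = (1/2^{nL}) ∑_{x̄} [∏_{j=1}^{n} (−1)^{∑_{k∈X} x_j^k}] ∑_{ā,b} (−1)^{b + ∑_{j,k} a_j^k} P(ā, b | x̄, y_X). Then ∑_{X ⊆ {1,…,L}} |K_X|^{1/n} = 2^{⌊L/2⌋}, which exceeds the classical bound 1. -/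

import Mathlib

open Real

/-- The cosine at an integer multiple of `π / 2` is the real part of a power of `I`. -/
lemma cos_pi_div_two_mul_natCast (m : ℕ) :
    Real.cos (π / 2 * m) = (Complex.I ^ m).re := by
  rw [← Complex.exp_pi_div_two_mul_I, ← Complex.exp_nat_mul,
    show (m : ℂ) * (π / 2 * Complex.I) = ((π / 2 * m : ℝ) : ℂ) * Complex.I by push_cast; ring,
    Complex.exp_ofReal_mul_I_re]

/-- The twisted binary-cube sum of `I ^ ∑ x` factorizes. -/
lemma sum_neg_one_pow_mul_I_pow (L : ℕ) (X : Finset (Fin L)) :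
    ∑ x : Fin L → Fin 2, (-1 : ℂ) ^ (∑ k ∈ X, (x k : ℕ)) * Complex.I ^ (∑ k, (x k : ℕ)) =
      (-Complex.I) ^ X.card * (1 + Complex.I) ^ L := by
  have h : ∀ x : Fin L → Fin 2,
      (-1 : ℂ) ^ (∑ k ∈ X, (x k : ℕ)) * Complex.I ^ (∑ k, (x k : ℕ)) =
        ∏ k, (if k ∈ X then (-1 : ℂ) else 1) ^ (x k : ℕ) * Complex.I ^ (x k : ℕ) := by
    intro x
    rw [Finset.prod_mul_distrib, Finset.prod_pow_eq_pow_sum, ← Finset.prod_pow_eq_pow_sum X]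
    congr 1
    simp only [ite_pow, one_pow, Finset.prod_ite_mem, Finset.univ_inter]
  simp_rw [h]
  rw [← Fintype.prod_sum (fun k (b : Fin 2) =>
    (if k ∈ X then (-1 : ℂ) else 1) ^ (b : ℕ) * Complex.I ^ (b : ℕ))]
  have h2 : ∀ k : Fin L, ∑ b : Fin 2,
      (if k ∈ X then (-1 : ℂ) else 1) ^ (b : ℕ) * Complex.I ^ (b : ℕ) =
        (if k ∈ X then -Complex.I else 1) * (1 + Complex.I) := by
    intro k
    rw [Fin.sum_univ_two]
    split_ifs
    · simp only [Fin.val_zero, Fin.val_one, pow_zero, pow_one]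
      linear_combination Complex.I_mul_I
    · simp
  simp_rw [h2]
  rw [Finset.prod_mul_distrib]
  simp

lemma one_add_I_pow_two_mul (h : ℕ) : (1 + Complex.I) ^ (2 * h) = 2 ^ h * Complex.I ^ h := by
  rw [pow_mul, ← mul_pow]
  congr 1
  linear_combination Complex.I_sq

lemma abs_re_neg_one_pow_mul_two_pow_mul (c h : ℕ) (z : ℂ) :
    |((-1 : ℂ) ^ c * 2 ^ h * z).re| = 2 ^ h * |z.re| := by
  have : (-1 : ℂ) ^ c * 2 ^ h * z = (((-1 : ℝ) ^ c * 2 ^ h : ℝ) : ℂ) * z := by push_cast; ring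
  rw [this, Complex.re_ofReal_mul, abs_mul, abs_mul, abs_pow, abs_pow]
  simp

lemma abs_re_I_pow_of_even {N : ℕ} (hN : Even N) : |(Complex.I ^ N).re| = 1 := by
  obtain ⟨m, rfl⟩ := hN
  rw [← two_mul, pow_mul, Complex.I_sq]
  rcases neg_one_pow_eq_or ℂ m with h | h <;> simp [h]

lemma abs_re_I_pow_mul_one_add_I (N : ℕ) : |(Complex.I ^ N * (1 + Complex.I)).re| = 1 := by
  obtain ⟨m, rfl | rfl⟩ := N.even_or_odd'
  · rw [pow_mul, Complex.I_sq]
    rcases neg_one_pow_eq_or ℂ m with h | h <;> simp [h]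
  · rw [pow_succ, pow_mul, Complex.I_sq]
    rcases neg_one_pow_eq_or ℂ m with h | h <;> simp [h]

/-- The single-source GHZ correlator has absolute value `2 ^ (L / 2)`, provided that Bob's
setting `m` has the right parity when `L` is even. -/
lemma abs_sum_neg_one_pow_mul_cos (L m : ℕ) (X : Finset (Fin L))
    (hm : Even L → Even (m + X.card + L / 2)) :
    |∑ x : Fin L → Fin 2, (-1 : ℝ) ^ (∑ k ∈ X, (x k : ℕ)) *
      Real.cos (π / 2 * (((∑ k, (x k : ℕ) : ℕ) : ℝ) + m))| = 2 ^ (L / 2) := by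
  have h : ∑ x : Fin L → Fin 2, (-1 : ℝ) ^ (∑ k ∈ X, (x k : ℕ)) *
      Real.cos (π / 2 * (((∑ k, (x k : ℕ) : ℕ) : ℝ) + m)) =
      (Complex.I ^ m * ((-Complex.I) ^ X.card * (1 + Complex.I) ^ L)).re := by
    rw [← sum_neg_one_pow_mul_I_pow, Finset.mul_sum, Complex.re_sum]
    refine Finset.sum_congr rfl fun x _ => ?_
    rw [← Nat.cast_add, cos_pi_div_two_mul_natCast, ← Complex.re_ofReal_mul]
    push_cast
    ring_nf
  rw [h, neg_pow]
  obtain ⟨l, rfl | rfl⟩ := L.even_or_odd'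
  · rw [one_add_I_pow_two_mul, show Complex.I ^ m * ((-1) ^ X.card * Complex.I ^ X.card *
      (2 ^ l * Complex.I ^ l)) = (-1) ^ X.card * 2 ^ l * Complex.I ^ (m + X.card + l) by ring,
      abs_re_neg_one_pow_mul_two_pow_mul]
    have := hm (even_two_mul l)
    rw [Nat.mul_div_cancel_left l two_pos] at this ⊢
    rw [abs_re_I_pow_of_even this, mul_one]
  · rw [pow_succ, one_add_I_pow_two_mul, show Complex.I ^ m * ((-1) ^ X.card *
      Complex.I ^ X.card * (2 ^ l * Complex.I ^ l * (1 + Complex.I))) =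
      (-1) ^ X.card * 2 ^ l * (Complex.I ^ (m + X.card + l) * (1 + Complex.I)) by ring,
      abs_re_neg_one_pow_mul_two_pow_mul, abs_re_I_pow_mul_one_add_I, mul_one]
    congr 1
    omega

/-- The full correlator of a distribution `2 ^ (-(n L + 1)) (1 + sign * C)` is `C`. -/
lemma sum_sign_mul_one_add_sign_mul (n L : ℕ) (C : ℝ) :
    ∑ a : Fin n → Fin L → Fin 2, ∑ b : Fin 2,
      (-1 : ℝ) ^ ((b : ℕ) + ∑ j : Fin n, ∑ k : Fin L, (a j k : ℕ)) *
        ((2 : ℝ)⁻¹ ^ (n * L + 1) *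
          (1 + (-1 : ℝ) ^ ((b : ℕ) + ∑ j : Fin n, ∑ k : Fin L, (a j k : ℕ)) * C)) = C := by
  have h : ∀ s : ℕ, ∑ b : Fin 2, (-1 : ℝ) ^ ((b : ℕ) + s) * ((2 : ℝ)⁻¹ ^ (n * L + 1) *
      (1 + (-1 : ℝ) ^ ((b : ℕ) + s) * C)) = (2 : ℝ)⁻¹ ^ (n * L) * C := by
    intro s
    rw [Fin.sum_univ_two, pow_succ]
    simp only [Fin.val_zero, Fin.val_one, zero_add, pow_add, pow_one]
    rcases neg_one_pow_eq_or ℝ s with hs | hs <;> rw [hs] <;> ring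
  simp_rw [h]
  rw [Finset.sum_const, Finset.card_univ, nsmul_eq_mul]
  simp only [Fintype.card_pi, Fintype.card_fin, Finset.prod_const, Finset.card_univ, ← pow_mul]
  push_cast
  rw [mul_comm L n, ← mul_assoc, ← mul_pow]
  norm_num

/-- **Quantum violation of the Bell-type inequality on `𝒩_n^L` (equation (27) of the
paper).**  With `R(L) = 1` if `L ≡ 0 (mod 4)` and `0` otherwise, Bob's setting
`y_X = (1 + (-1)^{|X|+R(L)})/2`, and the GHZ outcome distribution
`P(ā,b|x̄,y) = 2^{-(nL+1)} (1 + (-1)^{b+∑ a_j^k} ∏_j cos((π/2)(∑_k x_j^k + y)))`,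
the correlators `K_X = 2^{-nL} ∑_{x̄} (∏_j (-1)^{∑_{k∈X} x_j^k}) ∑_{ā,b}
(-1)^{b+∑ a_j^k} P(ā,b|x̄,y_X)` satisfy
`∑_{X ⊆ {1,…,L}} |K_X|^{1/n} = 2^{⌊L/2⌋} > 1`. -/
theorem quantum_violation_connected_network
    (n L : ℕ) (hn : 1 ≤ n) (hL : 2 ≤ L)
    (R : ℕ) (hR : R = if L % 4 = 0 then 1 else 0)
    (y : Finset (Fin L) → ℝ)
    (hy : ∀ X : Finset (Fin L), y X = (1 + (-1 : ℝ) ^ (X.card + R)) / 2)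
    (P : (Fin n → Fin L → Fin 2) → Fin 2 → (Fin n → Fin L → Fin 2) → ℝ → ℝ)
    (hP : ∀ a b x yv, P a b x yv =
      (2 : ℝ)⁻¹ ^ (n * L + 1) *
        (1 + (-1 : ℝ) ^ ((b : ℕ) + ∑ j : Fin n, ∑ k : Fin L, (a j k : ℕ)) *
          ∏ j : Fin n, Real.cos (π / 2 * ((∑ k : Fin L, (x j k : ℕ)) + yv))))
    (K : Finset (Fin L) → ℝ)
    (hK : ∀ X : Finset (Fin L), K X =
      (1 / 2 ^ (n * L)) * ∑ x : Fin n → Fin L → Fin 2,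
        (∏ j : Fin n, (-1 : ℝ) ^ (∑ k ∈ X, (x j k : ℕ))) *
          ∑ a : Fin n → Fin L → Fin 2, ∑ b : Fin 2,
            (-1 : ℝ) ^ ((b : ℕ) + ∑ j : Fin n, ∑ k : Fin L, (a j k : ℕ)) *
              P a b x (y X)) :
    ∑ X : Finset (Fin L), |K X| ^ ((1 : ℝ) / n) = 2 ^ (L / 2) ∧
      (1 : ℝ) < 2 ^ (L / 2) := by
  refine ⟨?_, one_lt_pow₀ one_lt_two (by omega)⟩
  have hn0 : n ≠ 0 := by omega
  have key : ∀ X, |K X| ^ ((1 : ℝ) / n) = (1 / 2 ^ L) * 2 ^ (L / 2) := by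
    intro X
    obtain ⟨m, hym, hm⟩ : ∃ m : ℕ, y X = m ∧ (Even L → Even (m + X.card + L / 2)) := by
      rcases Nat.even_or_odd (X.card + R) with h | h
      · refine ⟨1, by rw [hy, h.neg_one_pow]; norm_num, fun hL' => ?_⟩
        rw [Nat.even_iff] at *
        split_ifs at hR <;> omega
      · refine ⟨0, by rw [hy, h.neg_one_pow]; norm_num, fun hL' => ?_⟩
        rw [Nat.odd_iff] at h
        rw [Nat.even_iff] at *
        split_ifs at hR <;> omega
    have hKX : K X = ((1 / 2 ^ L) * ∑ x : Fin L → Fin 2, (-1 : ℝ) ^ (∑ k ∈ X, (x k : ℕ)) *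
        Real.cos (π / 2 * (((∑ k, (x k : ℕ) : ℕ) : ℝ) + m))) ^ n := by
      rw [hK, mul_pow, Fintype.sum_pow, one_div_pow, ← pow_mul, mul_comm L n]
      simp_rw [hP, sum_sign_mul_one_add_sign_mul, ← Finset.prod_mul_distrib, hym]
    rw [hKX, abs_pow, one_div (n : ℝ), Real.pow_rpow_inv_natCast (abs_nonneg _) hn0, abs_mul,
      abs_sum_neg_one_pow_mul_cos L m X hm, abs_of_pos (by positivity)]
  rw [Finset.sum_congr rfl fun X _ => key X, Finset.sum_const, Finset.card_univ,
    Fintype.card_finset, Fintype.card_fin, nsmul_eq_mul]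
  push_cast
  field_simp
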